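/- For every positive integer k, H(k) = 0 if and only if there exists a prime q dividing k with H(q) = 0. -/

import Mathlib

/-- A coprime-multiplicative function that shrinks prime powers shrinks every `n > 1`. -/
theorem lt_self_of_multiplicative (f : ℕ → ℕ)
    (hmul : ∀ m n : ℕ, Nat.Coprime m n → f (m * n) = f m * f n)
    (hI : ∀ p α : ℕ, p.Prime → 1 ≤ α → f (p ^ α) < p ^ α) (n : ℕ) : 1 < n → f n < n := by
  induction n using Nat.recOnPosPrimePosCoprime with
  | zero => intro h; omega
  | one => intro h; omega
  | prime_pow p a hp ha => exact fun _ => hI p a hp ha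
  | coprime a b ha hb hab iha ihb =>
    intro _
    rw [hmul a b hab]
    exact Nat.mul_lt_mul'' (iha ha) (ihb hb)

theorem exists_prime_dvd_of_prime_dvd_apply (f : ℕ → ℕ) (hf1 : f 1 = 1)
    (hmul : ∀ m n : ℕ, Nat.Coprime m n → f (m * n) = f m * f n)
    (hIII : ∀ p α q : ℕ, p.Prime → 1 ≤ α → q.Prime → q ∣ f (p ^ α) → q ∣ p * f p)
    {q : ℕ} (hq : q.Prime) (n : ℕ) :
    0 < n → q ∣ f n → ∃ p : ℕ, p.Prime ∧ p ∣ n ∧ q ∣ p * f p := by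
  induction n using Nat.recOnPosPrimePosCoprime with
  | zero => intro h; omega
  | one =>
    intro _ h
    rw [hf1] at h
    exact absurd h hq.not_dvd_one
  | prime_pow p a hp ha =>
    exact fun _ h => ⟨p, hp, dvd_pow_self p (by omega), hIII p a q hp ha hq h⟩
  | coprime a b ha hb hab iha ihb =>
    intro _ h
    rw [hmul a b hab] at h
    rcases (hq.dvd_mul).1 h with h | h
    · obtain ⟨p, hp, hpa, hqp⟩ := iha (by omega) h
      exact ⟨p, hp, hpa.mul_right b, hqp⟩
    · obtain ⟨p, hp, hpb, hqp⟩ := ihb (by omega) h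
      exact ⟨p, hp, hpb.mul_left a, hqp⟩

theorem apply_prime_dvd_apply (f : ℕ → ℕ)
    (hmul : ∀ m n : ℕ, Nat.Coprime m n → f (m * n) = f m * f n)
    (hII : ∀ p α : ℕ, p.Prime → 1 ≤ α → f p ∣ f (p ^ α))
    {p n : ℕ} (hp : p.Prime) (hn : 0 < n) (hpn : p ∣ n) : f p ∣ f n := by
  obtain ⟨a, m, hm, rfl⟩ := Nat.exists_eq_pow_mul_and_not_dvd hn.ne' p hp.ne_one
  have ha : 1 ≤ a := by
    rcases Nat.eq_zero_or_pos a with rfl | h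
    · simp at hpn
      exact absurd hpn hm
    · exact h
  rw [hmul _ _ (((Nat.Prime.coprime_iff_not_dvd hp).2 hm).pow_left a)]
  exact (hII p a hp ha).mul_right _

/-- If `f` fixes `0` and `1` and decreases elsewhere, then an orbit starting at `n` that
reaches `0` does so within `n` steps. -/
theorem iterate_self_eq_zero_iff (f : ℕ → ℕ) (hf0 : f 0 = 0) (hf1 : f 1 = 1)
    (hlt : ∀ n, 1 < n → f n < n) (n : ℕ) : f^[n] n = 0 ↔ ∃ j, f^[j] n = 0 := by
  have fix0 : ∀ j, f^[j] 0 = 0 := Function.iterate_fixed hf0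
  have fix1 : ∀ j, f^[j] 1 = 1 := Function.iterate_fixed hf1
  have key : ∀ m n, n ≤ m → (∃ j, f^[j] n = 0) → f^[m] n = 0 := by
    intro m
    induction m with
    | zero => intro n hn _; simpa using hn
    | succ m ih =>
      rintro n hn ⟨j, hj⟩
      have hj' : f^[j] (f n) = 0 := by
        rw [← Function.iterate_succ_apply, Function.iterate_succ_apply', hj, hf0]
      rcases lt_trichotomy n 1 with h | rfl | h
      · obtain rfl : n = 0 := by omega
        exact fix0 _
      · rw [fix1] at hj
        omega
      · rw [Function.iterate_succ_apply]
        exact ih _ (by have := hlt n h; omega) ⟨j, hj'⟩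
  exact ⟨fun h => ⟨n, h⟩, key n n le_rfl⟩

theorem stmt14 (f : ℕ → ℕ) (hf0 : f 0 = 0) (hf1 : f 1 = 1)
    (hmul : ∀ m n : ℕ, Nat.Coprime m n → f (m * n) = f m * f n)
    (hI : ∀ p α : ℕ, p.Prime → 1 ≤ α → f (p ^ α) < p ^ α)
    (hII : ∀ p α : ℕ, p.Prime → 1 ≤ α → f p ∣ f (p ^ α))
    (hIII : ∀ p α q : ℕ, p.Prime → 1 ≤ α → q.Prime → q ∣ f (p ^ α) → q ∣ p * f p) :
    ∀ k : ℕ, 0 < k → (f^[k] k = 0 ↔ ∃ q : ℕ, q.Prime ∧ q ∣ k ∧ f^[q] q = 0) := by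
  have hlt := lt_self_of_multiplicative f hmul hI
  simp only [iterate_self_eq_zero_iff f hf0 hf1 hlt]
  have step : ∀ n, (∃ j, f^[j] n = 0) ↔ ∃ j, f^[j] (f n) = 0 := by
    intro n
    constructor
    · rintro ⟨j, hj⟩
      exact ⟨j, by rw [← Function.iterate_succ_apply, Function.iterate_succ_apply', hj, hf0]⟩
    · rintro ⟨j, hj⟩
      exact ⟨j + 1, hj⟩
  intro k
  induction k using Nat.strong_induction_on with
  | _ k ih =>
    intro hk
    rcases Nat.lt_or_ge 1 k with hk1 | hk1
    · have hle : ∀ {p : ℕ}, p.Prime → p ∣ k → f p < k := fun hp hpk =>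
        (hlt _ hp.one_lt).trans_le (Nat.le_of_dvd hk hpk)
      constructor
      · intro h
        rcases Nat.eq_zero_or_pos (f k) with h0 | hpos
        · obtain ⟨q, hkq, hq⟩ := Nat.exists_infinite_primes (k + 1)
          obtain ⟨p, hp, hpk, hqp⟩ := exists_prime_dvd_of_prime_dvd_apply f hf1 hmul hIII hq k hk
            (h0 ▸ dvd_zero q)
          refine ⟨p, hp, hpk, 1, ?_⟩
          rcases (hq.dvd_mul).1 hqp with hd | hd
          · have := Nat.le_of_dvd hk (hd.trans hpk)
            omega
          · exact Nat.eq_zero_of_dvd_of_lt hd ((hle hp hpk).trans hkq)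
        · obtain ⟨q, hq, hqf, hqz⟩ := (ih _ (hlt k hk1) hpos).1 ((step k).1 h)
          obtain ⟨p, hp, hpk, hqp⟩ :=
            exists_prime_dvd_of_prime_dvd_apply f hf1 hmul hIII hq k hk hqf
          refine ⟨p, hp, hpk, ?_⟩
          rcases (hq.dvd_mul).1 hqp with hd | hd
          · rwa [← (Nat.prime_dvd_prime_iff_eq hq hp).1 hd]
          · rw [step]
            rcases Nat.eq_zero_or_pos (f p) with hp0 | hppos
            · exact ⟨0, hp0⟩
            · exact (ih _ (hle hp hpk) hppos).2 ⟨q, hq, hd, hqz⟩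
      · rintro ⟨p, hp, hpk, hpz⟩
        have hd := apply_prime_dvd_apply f hmul hII hp hk hpk
        rw [step]
        rcases Nat.eq_zero_or_pos (f k) with h0 | hpos
        · exact ⟨0, h0⟩
        · obtain ⟨q, hq, hqf, hqz⟩ :=
            (ih _ (hle hp hpk) (Nat.pos_of_dvd_of_pos hd hpos)).1 ((step p).1 hpz)
          exact (ih _ (hlt k hk1) hpos).2 ⟨q, hq, hqf.trans hd, hqz⟩
    · obtain rfl : k = 1 := by omega
      constructor
      · rintro ⟨j, hj⟩
        rw [Function.iterate_fixed hf1] at hj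
        omega
      · rintro ⟨q, hq, hq1, -⟩
        exact absurd hq1 hq.not_dvd_one
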